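/- (Topological exactness) If U is a subset of R=[0,1]×[−1,1] with nonempty interior, then there exists n∈ℕ such that T^n(U∩M)=M. -/

import Mathlib

noncomputable section

open Set Filter MeasureTheory Topology

/-- The Gauss map `G(ρ) = {1/ρ}`, `G(0) = 0`. -/
def gaussMap (ρ : ℝ) : ℝ := if ρ = 0 then 0 else Int.fract (1 / ρ)

/-- The fiber maps `T_ρ : [-1,1] → [-1,1]` of the skew product. -/
def fiberMap (ρ α : ℝ) : ℝ :=
  if ρ = 0 then 0
  else if α ≤ 0 then -α
  else if α ≤ ρ * gaussMap ρ then -α / (ρ * gaussMap ρ)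
  else Int.fract ((1 - α) / ρ)

/-- The skew product `T(ρ,α) = (G(ρ), T_ρ(α))`. -/
def skewProd (p : ℝ × ℝ) : ℝ × ℝ := (gaussMap p.1, fiberMap p.1 p.2)

/-- The rectangle `R = [0,1] × [-1,1]`. -/
def Rect : Set (ℝ × ℝ) := Icc (0 : ℝ) 1 ×ˢ Icc (-1 : ℝ) 1

/-- `M = ([0,1] ∖ ℚ) × [-1,1]`. -/
def Mset : Set (ℝ × ℝ) := {p | p ∈ Rect ∧ Irrational p.1}

/-- The `n`-th partial quotient of the continued fraction expansion of `θ`: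
`a_n(θ) = ⌊1 / Gⁿ(θ)⌋`. -/
def pquot (θ : ℝ) (n : ℕ) : ℕ := ⌊1 / gaussMap^[n] θ⌋₊

/-- The set `𝔼_∞` of irrational numbers in `(0,1)` all of whose partial quotients are even
and tend to infinity. -/
def Einf : Set ℝ :=
  {θ | θ ∈ Ioo (0 : ℝ) 1 ∧ Irrational θ ∧ (∀ n, Even (pquot θ n)) ∧
    Tendsto (fun n => pquot θ n) atTop atTop}

/-- The irrational numbers of the unit interval. -/
def irrUnit : Set ℝ := {x | 0 < x ∧ x < 1 ∧ Irrational x}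

lemma mem_Mset_iff {p : ℝ × ℝ} : p ∈ Mset ↔ p.1 ∈ irrUnit ∧ p.2 ∈ Icc (-1 : ℝ) 1 := by
  constructor
  · rintro ⟨⟨⟨h0, h1⟩, h2⟩, hirr⟩
    exact ⟨⟨lt_of_le_of_ne h0 hirr.ne_zero.symm, lt_of_le_of_ne h1 hirr.ne_one, hirr⟩, h2⟩
  · rintro ⟨⟨h0, h1, hirr⟩, h2⟩
    exact ⟨⟨⟨h0.le, h1.le⟩, h2⟩, hirr⟩

lemma gaussMap_mem {s : ℝ} (hs : s ∈ irrUnit) : gaussMap s ∈ irrUnit := by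
  obtain ⟨h0, -, hirr⟩ := hs
  have h : Irrational (gaussMap s) := by
    rw [gaussMap, if_neg h0.ne', Int.fract, one_div]
    exact hirr.inv.sub_intCast _
  refine ⟨lt_of_le_of_ne ?_ h.ne_zero.symm, ?_, h⟩
  · rw [gaussMap, if_neg h0.ne']
    exact Int.fract_nonneg _
  · rw [gaussMap, if_neg h0.ne']
    exact Int.fract_lt_one _

lemma exists_eq_inv_natCast_add_gaussMap {s : ℝ} (hs : s ∈ irrUnit) :
    ∃ n : ℕ, 1 ≤ n ∧ s = ((n : ℝ) + gaussMap s)⁻¹ := by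
  obtain ⟨h0, h1, -⟩ := hs
  have h1s : 1 ≤ 1 / s := (one_le_div h0).2 h1.le
  refine ⟨⌊1 / s⌋₊, Nat.one_le_floor_iff _ |>.2 h1s, ?_⟩
  have h : (⌊1 / s⌋₊ : ℝ) = (⌊1 / s⌋ : ℤ) := natCast_floor_eq_intCast_floor (by positivity)
  rw [gaussMap, if_neg h0.ne', h, Int.floor_add_fract, one_div, inv_inv]

lemma inv_natCast_add_mem {n : ℕ} (hn : 1 ≤ n) {x : ℝ} (hx : x ∈ irrUnit) :
    ((n : ℝ) + x)⁻¹ ∈ irrUnit := by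
  obtain ⟨h0, -, hirr⟩ := hx
  have hn' : (1 : ℝ) ≤ n := by exact_mod_cast hn
  exact ⟨by positivity, inv_lt_one_of_one_lt₀ (by linarith), (hirr.natCast_add n).inv⟩

lemma gaussMap_inv_natCast_add {n : ℕ} {x : ℝ} (hx : x ∈ irrUnit) :
    gaussMap ((n : ℝ) + x)⁻¹ = x := by
  obtain ⟨h0, h1, -⟩ := hx
  have : (0 : ℝ) < n + x := by positivity
  rw [gaussMap, if_neg (inv_pos.2 this).ne', one_div, inv_inv, Int.fract_natCast_add,
    Int.fract_eq_self.2 ⟨h0.le, h1⟩]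

lemma abs_inv_sub_inv_le {n m x y : ℝ} (hn : 1 ≤ n) (hm : 1 ≤ m) (hx : 0 < x) (hy : 0 < y) :
    |(n + (m + x)⁻¹)⁻¹ - (n + (m + y)⁻¹)⁻¹| ≤ |x - y| / 4 := by
  have hX : 2 ≤ n * (m + x) + 1 := by nlinarith
  have hY : 2 ≤ n * (m + y) + 1 := by nlinarith
  have hmx : 0 < m + x := by linarith
  have hmy : 0 < m + y := by linarith
  have key : (n + (m + x)⁻¹)⁻¹ - (n + (m + y)⁻¹)⁻¹ =
      (x - y) / ((n * (m + x) + 1) * (n * (m + y) + 1)) := by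
    have h1 : n + (m + x)⁻¹ = (n * (m + x) + 1) / (m + x) := by field_simp
    have h2 : n + (m + y)⁻¹ = (n * (m + y) + 1) / (m + y) := by field_simp
    rw [h1, h2, inv_div, inv_div, div_sub_div _ _ (by positivity) (by positivity)]
    congr 1
    ring
  rw [key, abs_div]
  refine div_le_div_of_nonneg_left (abs_nonneg _) (by norm_num) ?_
  refine le_trans ?_ (le_abs_self _)
  nlinarith

/-- Preimages of a point under even iterates of the Gauss map are dense, at a uniform rate. -/
lemma exists_gaussMap_iterate_eq (i : ℕ) {s t : ℝ} (hs : s ∈ irrUnit) (ht : t ∈ irrUnit) :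
    ∃ r ∈ irrUnit, gaussMap^[2 * i] r = t ∧ |r - s| ≤ (1 / 4) ^ i := by
  induction i generalizing s with
  | zero =>
    refine ⟨t, ht, rfl, ?_⟩
    rw [pow_zero, abs_le]
    constructor <;> linarith [hs.1, hs.2.1, ht.1, ht.2.1]
  | succ i ih =>
    obtain ⟨n, hn, hsn⟩ := exists_eq_inv_natCast_add_gaussMap hs
    have hs' := gaussMap_mem hs
    obtain ⟨m, hm, hsm⟩ := exists_eq_inv_natCast_add_gaussMap hs'
    have hs'' := gaussMap_mem hs'
    obtain ⟨r, hr, hrt, hrs⟩ := ih hs''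
    have hr' := inv_natCast_add_mem hm hr
    refine ⟨((n : ℝ) + ((m : ℝ) + r)⁻¹)⁻¹, inv_natCast_add_mem hn hr', ?_, ?_⟩
    · rw [show 2 * (i + 1) = 2 * i + 1 + 1 by ring, Function.iterate_succ_apply,
        Function.iterate_succ_apply, gaussMap_inv_natCast_add hr', gaussMap_inv_natCast_add hr,
        hrt]
    · rw [hsn, hsm]
      refine (abs_inv_sub_inv_le (by exact_mod_cast hn) (by exact_mod_cast hm)
        hr.1 hs''.1).trans ?_
      rw [pow_succ]
      linarith

lemma fiberMap_of_nonpos {ρ α : ℝ} (hρ : ρ ≠ 0) (hα : α ≤ 0) : fiberMap ρ α = -α := by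
  rw [fiberMap, if_neg hρ, if_pos hα]

lemma fiberMap_of_le {ρ α : ℝ} (hρ : ρ ≠ 0) (h0 : 0 < α) (hα : α ≤ ρ * gaussMap ρ) :
    fiberMap ρ α = -α / (ρ * gaussMap ρ) := by
  rw [fiberMap, if_neg hρ, if_neg h0.not_ge, if_pos hα]

lemma fiberMap_of_lt {ρ α : ℝ} (hρ : ρ ≠ 0) (h0 : 0 < α) (hα : ρ * gaussMap ρ < α) :
    fiberMap ρ α = Int.fract ((1 - α) / ρ) := by
  rw [fiberMap, if_neg hρ, if_neg h0.not_ge, if_neg hα.not_ge]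

lemma mul_gaussMap_pos {ρ : ℝ} (hρ : ρ ∈ irrUnit) : 0 < ρ * gaussMap ρ :=
  mul_pos hρ.1 (gaussMap_mem hρ).1

lemma mul_gaussMap_lt {ρ : ℝ} (hρ : ρ ∈ irrUnit) : ρ * gaussMap ρ < ρ :=
  mul_lt_of_lt_one_right hρ.1 (gaussMap_mem hρ).2.1

lemma mul_gaussMap_add_le_one {ρ : ℝ} (hρ : ρ ∈ irrUnit) : ρ * gaussMap ρ + ρ ≤ 1 := by
  obtain ⟨n, hn, h⟩ := exists_eq_inv_natCast_add_gaussMap hρ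
  have hn' : (1 : ℝ) ≤ n := by exact_mod_cast hn
  have hg := (gaussMap_mem hρ).1
  have : ρ * ((n : ℝ) + gaussMap ρ) = 1 := by
    nth_rewrite 1 [h]
    exact inv_mul_cancel₀ (by positivity)
  nlinarith [hρ.1]

lemma skewProd_mapsTo : MapsTo skewProd Mset Mset := by
  rintro ⟨ρ, α⟩ h
  rw [mem_Mset_iff] at h ⊢
  obtain ⟨hρ, h1, h2⟩ := h
  refine ⟨gaussMap_mem hρ, ?_⟩
  change fiberMap ρ α ∈ _
  have hb := mul_gaussMap_pos hρ
  rcases le_or_gt α 0 with h0 | h0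
  · rw [fiberMap_of_nonpos hρ.1.ne' h0]
    constructor <;> simp only at * <;> linarith
  rcases le_or_gt α (ρ * gaussMap ρ) with hα | hα
  · rw [fiberMap_of_le hρ.1.ne' h0 hα, neg_div]
    have h3 : α / (ρ * gaussMap ρ) ≤ 1 := (div_le_one hb).2 hα
    have h4 : 0 < α / (ρ * gaussMap ρ) := by positivity
    constructor <;> linarith
  · rw [fiberMap_of_lt hρ.1.ne' h0 hα]
    exact ⟨by linarith [Int.fract_nonneg ((1 - α) / ρ)], (Int.fract_lt_one _).le⟩

lemma exists_Ioo_subset_fract_image {x y l : ℝ} (hl0 : 0 ≤ l) (hl1 : l ≤ 1) (hxy : 2 * l ≤ y - x) :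
    ∃ c d : ℝ, 0 ≤ c ∧ d ≤ 1 ∧ l ≤ d - c ∧ Ioo c d ⊆ Int.fract '' Ioo x y := by
  have h0 := Int.floor_le x
  have h1 := Int.lt_floor_add_one x
  have hfr (j : ℤ) {v : ℝ} (hv0 : 0 ≤ v) (hv1 : v < 1) : Int.fract ((j : ℝ) + v) = v := by
    rw [Int.fract_intCast_add, Int.fract_eq_self.2 ⟨hv0, hv1⟩]
  rcases le_or_gt l (⌊x⌋ + 1 - x) with h | h
  · refine ⟨x - ⌊x⌋, min 1 (y - ⌊x⌋), by linarith, min_le_left _ _, ?_, ?_⟩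
    · rw [le_sub_iff_add_le, le_min_iff]
      exact ⟨by linarith, by linarith⟩
    · rintro v ⟨hv, hv'⟩
      obtain ⟨hv1, hv2⟩ := lt_min_iff.1 hv'
      exact ⟨⌊x⌋ + v, ⟨by linarith, by linarith⟩, hfr _ (by linarith) hv1⟩
  · refine ⟨0, min 1 (y - ⌊x⌋ - 1), le_rfl, min_le_left _ _, ?_, ?_⟩
    · rw [sub_zero, le_min_iff]
      exact ⟨hl1, by linarith⟩
    · rintro v ⟨hv, hv'⟩
      obtain ⟨hv1, hv2⟩ := lt_min_iff.1 hv'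
      refine ⟨(⌊x⌋ + 1 : ℤ) + v, ⟨?_, ?_⟩, hfr _ hv.le hv1⟩ <;> push_cast <;> linarith

/-- The image of an interval under a fiber map contains an interval of comparable length. -/
lemma exists_Ioo_subset_fiberMap_image {ρ c d : ℝ} (hρ : ρ ∈ irrUnit) (hc : -1 ≤ c)
    (hd : d ≤ 1) (hcd : c < d) :
    ∃ c' d' : ℝ, -1 ≤ c' ∧ d' ≤ 1 ∧ (d - c) / 8 ≤ d' - c' ∧
      Ioo c' d' ⊆ fiberMap ρ '' Ioo c d := by
  have hb := mul_gaussMap_pos hρ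
  have hbρ := mul_gaussMap_lt hρ
  have hρ0 := hρ.1
  have hρ1 := hρ.2.1
  set b := ρ * gaussMap ρ with hb_def
  rcases le_or_gt ((c + d) / 2) 0 with hm | hm
  · refine ⟨-((c + d) / 2), -c, by linarith, by linarith, by linarith, ?_⟩
    rintro v ⟨hv1, hv2⟩
    refine ⟨-v, ⟨by linarith, by linarith⟩, ?_⟩
    rw [fiberMap_of_nonpos hρ0.ne' (by linarith), neg_neg]
  rcases le_or_gt ((c + d) / 2 + (d - c) / 4) b with hq | hq
  · refine ⟨-(((c + d) / 2 + (d - c) / 4) / b), -(((c + d) / 2) / b), ?_, ?_, ?_, ?_⟩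
    · linarith [(div_le_one hb).2 hq]
    · have : 0 < (c + d) / 2 / b := by positivity
      linarith
    · have : (d - c) / 4 ≤ (d - c) / 4 / b :=
        le_div_self (by linarith) hb (by linarith)
      rw [add_div ((c + d) / 2)]
      linarith
    · rintro v ⟨hv1, hv2⟩
      have h1 : -v * b < (c + d) / 2 + (d - c) / 4 := (lt_div_iff₀ hb).1 (by linarith)
      have h2 : (c + d) / 2 < -v * b := (div_lt_iff₀ hb).1 (by linarith)
      refine ⟨-v * b, ⟨by linarith, by linarith⟩, ?_⟩
      rw [fiberMap_of_le hρ0.ne' (by linarith) (by linarith), ← hb_def]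
      field_simp
  · have hlen : 2 * ((d - c) / 8) ≤
        (1 - ((c + d) / 2 + (d - c) / 4)) / ρ - (1 - d) / ρ := by
      rw [← sub_div, le_div_iff₀ hρ0]
      nlinarith
    obtain ⟨c', d', hc', hd', hl, hsub⟩ :=
      exists_Ioo_subset_fract_image (by linarith) (by linarith) hlen
    refine ⟨c', d', by linarith, hd', hl, hsub.trans ?_⟩
    rintro _ ⟨v, ⟨hv1, hv2⟩, rfl⟩
    rw [div_lt_iff₀ hρ0] at hv1
    rw [lt_div_iff₀ hρ0] at hv2
    refine ⟨1 - v * ρ, ⟨by linarith, by linarith⟩, ?_⟩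
    rw [fiberMap_of_lt hρ0.ne' (by linarith) (by linarith), sub_sub_cancel,
      mul_div_cancel_right₀ _ hρ0.ne']

lemma exists_Ioo_lift_iterate (n : ℕ) {ρ c d : ℝ} (hρ : ρ ∈ irrUnit) (hc : -1 ≤ c)
    (hd : d ≤ 1) (hcd : c < d) :
    ∃ c' d' : ℝ, -1 ≤ c' ∧ d' ≤ 1 ∧ (d - c) / 8 ^ n ≤ d' - c' ∧
      ∀ β ∈ Ioo c' d', ∃ α ∈ Ioo c d, skewProd^[n] (ρ, α) = (gaussMap^[n] ρ, β) := by
  induction n with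
  | zero => exact ⟨c, d, hc, hd, by simp, fun β hβ => ⟨β, hβ, rfl⟩⟩
  | succ n ih =>
    obtain ⟨c₁, d₁, hc₁, hd₁, hl, h⟩ := ih
    have hlen : 0 < (d - c) / 8 ^ n := div_pos (by linarith) (by positivity)
    have hρn : gaussMap^[n] ρ ∈ irrUnit := MapsTo.iterate (fun _ hx => gaussMap_mem hx) n hρ
    obtain ⟨c₂, d₂, hc₂, hd₂, hl₂, h₂⟩ :=
      exists_Ioo_subset_fiberMap_image hρn hc₁ hd₁ (by linarith)
    refine ⟨c₂, d₂, hc₂, hd₂, ?_, fun β hβ => ?_⟩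
    · rw [pow_succ, ← div_div]
      linarith
    · obtain ⟨β', hβ', rfl⟩ := h₂ hβ
      obtain ⟨α, hα, hαβ⟩ := h β' hβ'
      refine ⟨α, hα, ?_⟩
      rw [Function.iterate_succ_apply', Function.iterate_succ_apply', hαβ]
      rfl

/-- When `ρ` is small, the fiber map takes a positive interval over `[0, 1)`. -/
lemma Ico_subset_fiberMap_image_Ioo {ρ c d : ℝ} (hρ : ρ ∈ irrUnit) (hc : 0 ≤ c)
    (hl : 3 * ρ ≤ d - c) : Ico 0 1 ⊆ fiberMap ρ '' Ioo c d := by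
  rintro v ⟨hv0, hv1⟩
  have hρ0 := hρ.1
  have hb := mul_gaussMap_lt hρ
  set x := (1 - d) / ρ with hx
  have hxρ : x * ρ = 1 - d := by rw [hx]; field_simp
  have h0 := Int.floor_le x
  have h1 := Int.lt_floor_add_one x
  set z : ℝ := (⌊x⌋ + 1 : ℤ) + v with hz
  have hz1 : x < z := by rw [hz]; push_cast; linarith
  have hz2 : z < x + 2 := by rw [hz]; push_cast; linarith
  have hz3 : x * ρ < z * ρ := by gcongr
  have hz4 : z * ρ < (x + 2) * ρ := by gcongr
  refine ⟨1 - z * ρ, ⟨by linarith, by linarith⟩, ?_⟩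
  rw [fiberMap_of_lt hρ0.ne' (by linarith) (by linarith), sub_sub_cancel,
    mul_div_cancel_right₀ _ hρ0.ne', hz, Int.fract_intCast_add, Int.fract_eq_self.2 ⟨hv0, hv1⟩]

lemma exists_mem_Ioo_fiberMap_eq {ρ v : ℝ} (hρ : ρ ∈ irrUnit) (hv : v ∈ Ico (-1 : ℝ) 0) :
    ∃ α ∈ Ioo (0 : ℝ) 1, fiberMap ρ α = v := by
  have hb := mul_gaussMap_pos hρ
  have hb1 := (mul_gaussMap_lt hρ).trans hρ.2.1
  have h0 : 0 < -v * (ρ * gaussMap ρ) := mul_pos (by linarith [hv.2]) hb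
  have h1 : -v * (ρ * gaussMap ρ) ≤ ρ * gaussMap ρ :=
    mul_le_of_le_one_left hb.le (by linarith [hv.1])
  refine ⟨-v * (ρ * gaussMap ρ), ⟨h0, by linarith⟩, ?_⟩
  rw [fiberMap_of_le hρ.1.ne' h0 h1, ← neg_mul, neg_neg, mul_div_cancel_right₀ _ hb.ne']

lemma Ico_subset_fiberMap_image_Ico {ρ : ℝ} (hρ : ρ ∈ irrUnit) :
    Ico (-1 : ℝ) 1 ⊆ fiberMap ρ '' Ico 0 1 := by
  rintro v ⟨hv1, hv2⟩
  rcases lt_trichotomy v 0 with h | rfl | h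
  · obtain ⟨α, hα, h⟩ := exists_mem_Ioo_fiberMap_eq hρ ⟨hv1, h⟩
    exact ⟨α, Ioo_subset_Ico_self hα, h⟩
  · exact ⟨0, ⟨le_rfl, one_pos⟩, by rw [fiberMap_of_nonpos hρ.1.ne' le_rfl, neg_zero]⟩
  · have hρ0 := hρ.1
    have hb := mul_gaussMap_pos hρ
    have hb1 := mul_gaussMap_add_le_one hρ
    have h1 : v * ρ < ρ := mul_lt_of_lt_one_left hρ0 hv2
    have h2 : 0 < v * ρ := mul_pos h hρ0
    refine ⟨1 - v * ρ, ⟨by linarith, by linarith⟩, ?_⟩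
    rw [fiberMap_of_lt hρ0.ne' (by linarith) (by linarith), sub_sub_cancel,
      mul_div_cancel_right₀ _ hρ0.ne', Int.fract_eq_self.2 ⟨h.le, hv2⟩]

lemma Icc_subset_fiberMap_image_Ico {ρ : ℝ} (hρ : ρ ∈ irrUnit) :
    Icc (-1 : ℝ) 1 ⊆ fiberMap ρ '' Ico (-1) 1 := by
  rintro v ⟨hv1, hv2⟩
  rcases lt_or_ge v 0 with h | h
  · obtain ⟨α, hα, h⟩ := exists_mem_Ioo_fiberMap_eq hρ ⟨hv1, h⟩
    exact ⟨α, ⟨by linarith [hα.1], hα.2⟩, h⟩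
  · exact ⟨-v, ⟨by linarith, by linarith⟩,
      by rw [fiberMap_of_nonpos hρ.1.ne' (by linarith), neg_neg]⟩

/-- Two consecutive small base points suffice to expand an interval over `[0, 1)`. -/
lemma Ico_subset_fiberMap_image_fiberMap_image {ρ c d : ℝ} (hρ : ρ ∈ irrUnit)
    (hcd : c < d) (hl : 6 * ρ ≤ d - c) (hl' : 6 * gaussMap ρ ≤ d - c) :
    Ico (0 : ℝ) 1 ⊆ fiberMap (gaussMap ρ) '' (fiberMap ρ '' Ioo c d) := by
  have hρ' := gaussMap_mem hρ
  rcases le_or_gt 0 ((c + d) / 2) with hm | hm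
  · have h1 : Ico (0 : ℝ) 1 ⊆ fiberMap ρ '' Ioo c d :=
      (Ico_subset_fiberMap_image_Ioo (d := d) hρ hm (by linarith)).trans
        (image_mono (Ioo_subset_Ioo_left (by linarith)))
    exact ((Ico_subset_Ico_left (by norm_num)).trans (Ico_subset_fiberMap_image_Ico hρ')).trans
      (image_mono h1)
  · refine (Ico_subset_fiberMap_image_Ioo (c := -((c + d) / 2)) (d := -c) hρ' (by linarith)
      (by linarith)).trans (image_mono ?_)
    rintro v ⟨hv1, hv2⟩
    refine ⟨-v, ⟨by linarith, by linarith⟩, ?_⟩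
    rw [fiberMap_of_nonpos hρ.1.ne' (by linarith), neg_neg]

lemma exists_Ioo_prod_subset {U : Set (ℝ × ℝ)} (hint : (interior U).Nonempty) :
    ∃ a b c d : ℝ, a < b ∧ c < d ∧ Ioo a b ×ˢ Ioo c d ⊆ U := by
  obtain ⟨⟨x, y⟩, hxy⟩ := hint
  obtain ⟨ε, hε, h⟩ := Metric.isOpen_iff.1 isOpen_interior _ hxy
  refine ⟨x - ε, x + ε, y - ε, y + ε, by linarith, by linarith, ?_⟩
  rw [← Real.ball_eq_Ioo, ← Real.ball_eq_Ioo, ball_prod_same]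
  exact h.trans interior_subset

/-- **Lemma 3.2 (topological exactness).** If `U ⊆ R` has nonempty interior, then some iterate
of the skew product `T` maps `U ∩ M` onto `M`. -/
theorem topologicallyExact (U : Set (ℝ × ℝ)) (hU : U ⊆ Rect)
    (hint : (interior U).Nonempty) :
    ∃ n : ℕ, skewProd^[n] '' (U ∩ Mset) = Mset := by
  obtain ⟨a, b, c, d, hab, hcd, hsub⟩ := exists_Ioo_prod_subset hint
  obtain ⟨s, hs_irr, has, hsb⟩ := exists_irrational_btwn hab
  have hbounds : Ioo c d ⊆ Icc (-1 : ℝ) 1 := fun y hy =>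
    (hU (hsub (show (s, y) ∈ Ioo a b ×ˢ Ioo c d from ⟨⟨has, hsb⟩, hy⟩))).2
  have hc : -1 ≤ c ∧ d ≤ 1 := by
    have := closure_minimal hbounds isClosed_Icc
    rw [closure_Ioo hcd.ne] at this
    exact ⟨(this ⟨le_rfl, hcd.le⟩).1, (this ⟨hcd.le, le_rfl⟩).2⟩
  have hs : s ∈ irrUnit := by
    obtain ⟨y, hy⟩ := exists_between hcd
    exact (mem_Mset_iff.1 (show (s, y) ∈ Mset from ⟨hU (hsub ⟨⟨has, hsb⟩, hy⟩), hs_irr⟩)).1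
  obtain ⟨i, hi⟩ := exists_pow_lt_of_lt_one
    (lt_min (sub_pos.2 has) (sub_pos.2 hsb)) (show (1 / 4 : ℝ) < 1 by norm_num)
  obtain ⟨hia, hib⟩ := lt_min_iff.1 hi
  set ε := (d - c) / 8 ^ (2 * i) with hε
  have hε0 : 0 < ε := div_pos (by linarith) (by positivity)
  obtain ⟨N, hN⟩ := exists_nat_gt (6 / ε)
  have hN0 : (0 : ℝ) < N := lt_trans (by positivity) hN
  have hN1 : 1 ≤ N := by exact_mod_cast hN0
  have hsmall {x : ℝ} (hx : x ∈ irrUnit) : 6 * ((N : ℝ) + x)⁻¹ ≤ ε := by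
    have := hx.1
    rw [← div_eq_mul_inv, div_le_iff₀ (by positivity)]
    rw [div_lt_iff₀ hε0] at hN
    nlinarith
  refine ⟨2 * i + 4, Subset.antisymm ?_ ?_⟩
  · rintro _ ⟨p, hp, rfl⟩
    exact skewProd_mapsTo.iterate _ hp.2
  rintro ⟨t, β⟩ ht
  obtain ⟨ht, hβ⟩ := mem_Mset_iff.1 ht
  simp only at ht hβ
  obtain ⟨u₁, hu₁, hg₁⟩ : ∃ u ∈ irrUnit, gaussMap u = t :=
    ⟨_, inv_natCast_add_mem le_rfl ht, gaussMap_inv_natCast_add ht⟩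
  obtain ⟨u₂, hu₂, hg₂⟩ : ∃ u ∈ irrUnit, gaussMap u = u₁ :=
    ⟨_, inv_natCast_add_mem le_rfl hu₁, gaussMap_inv_natCast_add hu₁⟩
  obtain ⟨u₃, hu₃, hg₃, hs₃⟩ : ∃ u ∈ irrUnit, gaussMap u = u₂ ∧ 6 * u ≤ ε :=
    ⟨_, inv_natCast_add_mem hN1 hu₂, gaussMap_inv_natCast_add hu₂, hsmall hu₂⟩
  obtain ⟨u₄, hu₄, hg₄, hs₄⟩ : ∃ u ∈ irrUnit, gaussMap u = u₃ ∧ 6 * u ≤ ε :=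
    ⟨_, inv_natCast_add_mem hN1 hu₃, gaussMap_inv_natCast_add hu₃, hsmall hu₃⟩
  obtain ⟨r, hr, hru, hrs⟩ := exists_gaussMap_iterate_eq i hs hu₄
  obtain ⟨hr1, hr2⟩ := abs_le.1 hrs
  obtain ⟨c', d', -, -, hl, hlift⟩ := exists_Ioo_lift_iterate (2 * i) hr hc.1 hc.2 hcd
  obtain ⟨β₁, hβ₁, rfl⟩ := Icc_subset_fiberMap_image_Ico hu₁ hβ
  obtain ⟨β₂, hβ₂, rfl⟩ := Ico_subset_fiberMap_image_Ico hu₂ hβ₁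
  obtain ⟨_, ⟨β₄, hβ₄, rfl⟩, rfl⟩ := Ico_subset_fiberMap_image_fiberMap_image hu₄
    (by linarith) (hs₄.trans hl) (by rw [hg₄]; exact hs₃.trans hl) hβ₂
  obtain ⟨α, hα, hiter⟩ := hlift β₄ hβ₄
  have hrU : (r, α) ∈ U := hsub ⟨⟨by linarith, by linarith⟩, hα⟩
  refine ⟨(r, α), ⟨hrU, hU hrU, hr.2.2⟩, ?_⟩
  rw [add_comm, Function.iterate_add_apply, hiter, hru]
  simp [skewProd, hg₁, hg₂, hg₃, hg₄]
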